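/- Let n ≥ 3, 2 ≤ k ≤ n, and let λ = (λ_1, …, λ_n) ∈ Γ_k satisfy λ_2 ≥ λ_3 ≥ ⋯ ≥ λ_n, λ_1 > 0, λ_n < 0, λ_1 ≥ δλ_2 and −λ_n ≥ ελ_1 for some constants δ, ε ∈ (0,1]. Then for every 1 ≤ m ≤ k−1: (−λ_n) · σ_{m−1}(λ|1n) ≥ εδ·(m/(n−1))·σ_m(λ). (Display (2.18) in the proof of Lemma 2.7.) -/

import Mathlib

open Finset

noncomputable def esymm {n : ℕ} (lam : Fin n → ℝ) (m : ℤ) : ℝ :=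
  if m < 0 then 0
  else ∑ s ∈ Finset.powersetCard m.toNat Finset.univ, ∏ i ∈ s, lam i

noncomputable def esymmDel {n : ℕ} (lam : Fin n → ℝ) (i : Fin n) (m : ℤ) : ℝ :=
  if m < 0 then 0
  else ∑ s ∈ Finset.powersetCard m.toNat (Finset.univ.erase i), ∏ j ∈ s, lam j

noncomputable def esymmDelSet {n : ℕ} (lam : Fin n → ℝ) (S : Finset (Fin n)) (m : ℤ) : ℝ :=
  if m < 0 then 0
  else ∑ s ∈ Finset.powersetCard m.toNat (Finset.univ \ S), ∏ j ∈ s, lam j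

def GardingCone (n k : ℕ) : Set (Fin n → ℝ) :=
  {lam | ∀ m : ℕ, 1 ≤ m → m ≤ k → 0 < esymm lam (m : ℤ)}

noncomputable def sigmaMat {n : ℕ} (A : Matrix (Fin n) (Fin n) ℝ) (m : ℤ) : ℝ :=
  if m < 0 then 0
  else ∑ s ∈ Finset.powersetCard m.toNat (Finset.univ : Finset (Fin n)),
    (A.submatrix (fun i : {x : Fin n // x ∈ s} => (i : Fin n))
                 (fun j : {x : Fin n // x ∈ s} => (j : Fin n))).det

/-- The `m`-th elementary symmetric polynomial of the entries `f i`, `i ∈ s`. -/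
noncomputable def esymmOn {ι : Type*} (f : ι → ℝ) (s : Finset ι) (m : ℕ) : ℝ :=
  ∑ t ∈ powersetCard m s, ∏ i ∈ t, f i

section esymmOn

variable {ι : Type*} (f : ι → ℝ)

@[simp]
theorem esymmOn_zero (s : Finset ι) : esymmOn f s 0 = 1 := by
  simp [esymmOn]

@[simp]
theorem esymmOn_empty_succ (m : ℕ) : esymmOn f ∅ (m + 1) = 0 := by
  rw [esymmOn, powersetCard_eq_empty.2 (by simp), sum_empty]

theorem esymmOn_insert_succ [DecidableEq ι] {s : Finset ι} {a : ι} (ha : a ∉ s) (m : ℕ) :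
    esymmOn f (insert a s) (m + 1) = esymmOn f s (m + 1) + f a * esymmOn f s m := by
  unfold esymmOn
  have hmem : ∀ t ∈ powersetCard m s, a ∉ t := fun t ht h => ha ((mem_powersetCard.1 ht).1 h)
  rw [powersetCard_succ_insert ha, sum_union, sum_image, mul_sum]
  · congr 1
    exact sum_congr rfl fun t ht => prod_insert (hmem t ht)
  · intro t ht u hu h
    rw [← erase_insert (hmem t ht), h, erase_insert (hmem u hu)]
  · rw [disjoint_left]
    intro t ht hu
    obtain ⟨u, _, rfl⟩ := mem_image.1 hu
    exact ha ((mem_powersetCard.1 ht).1 (mem_insert_self a u))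

theorem esymmOn_eq_erase [DecidableEq ι] {s : Finset ι} {a : ι} (ha : a ∈ s) (m : ℕ) :
    esymmOn f s (m + 1) = esymmOn f (s.erase a) (m + 1) + f a * esymmOn f (s.erase a) m := by
  conv_lhs => rw [← insert_erase ha]
  exact esymmOn_insert_succ f (notMem_erase a s) m

theorem sum_mul_esymmOn_erase [DecidableEq ι] (s : Finset ι) (m : ℕ) :
    ∑ i ∈ s, f i * esymmOn f (s.erase i) m = (m + 1) * esymmOn f s (m + 1) := by
  induction s using Finset.induction_on generalizing m with
  | empty => simp
  | insert a s ha ih =>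
    rw [sum_insert ha, erase_insert ha, esymmOn_insert_succ f ha]
    have hne : ∀ i ∈ s, (insert a s).erase i = insert a (s.erase i) := fun i hi =>
      erase_insert_of_ne fun h => ha (h ▸ hi)
    cases m with
    | zero =>
      have h := ih 0
      simp only [esymmOn_zero, mul_one, Nat.cast_zero, zero_add, one_mul] at h ⊢
      rw [h]
      ring
    | succ m =>
      have hsum : ∑ i ∈ s, f i * esymmOn f ((insert a s).erase i) (m + 1) =
          ∑ i ∈ s, f i * esymmOn f (s.erase i) (m + 1) +
            f a * ∑ i ∈ s, f i * esymmOn f (s.erase i) m := by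
        rw [mul_sum, ← sum_add_distrib]
        refine sum_congr rfl fun i hi => ?_
        rw [hne i hi, esymmOn_insert_succ f fun h => ha (mem_of_mem_erase h)]
        ring
      rw [hsum, ih, ih]
      push_cast
      ring

end esymmOn

section Newton

open Polynomial

theorem Polynomial.Splits.real_derivative {p : ℝ[X]} (hp : p.Splits) : p.derivative.Splits := by
  rcases Nat.eq_zero_or_pos p.natDegree with h0 | h0
  · rw [eq_C_of_natDegree_eq_zero h0, derivative_C]
    exact Splits.zero
  · rw [splits_iff_card_roots] at hp ⊢
    have h1 := card_roots_le_derivative p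
    have h2 := card_roots' p.derivative
    have h3 := natDegree_derivative_lt h0.ne'
    omega

theorem Polynomial.Splits.eval_mul_eval_derivative_derivative_le {p : ℝ[X]} (hp : p.Splits)
    (x : ℝ) :
    p.eval x * p.derivative.derivative.eval x ≤ p.derivative.eval x ^ 2 := by
  obtain ⟨m, hm⟩ := splits_iff_exists_multiset.1 hp
  rw [hm]
  have key : ∀ m : Multiset ℝ, ((m.map (X - C ·)).prod).eval x *
      ((m.map (X - C ·)).prod).derivative.derivative.eval x ≤
        ((m.map (X - C ·)).prod).derivative.eval x ^ 2 := by
    intro m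
    induction m using Multiset.induction_on with
    | empty => simp
    | cons r m ih =>
      simp only [Multiset.map_cons, Multiset.prod_cons]
      generalize (m.map (X - C ·)).prod = q at ih ⊢
      simp only [derivative_mul, derivative_add, derivative_sub, derivative_X, derivative_C,
        eval_mul, eval_add, eval_sub, eval_X, eval_C, sub_zero,
        one_mul]
      nlinarith [mul_nonneg (sq_nonneg (x - r)) (sub_nonneg.2 ih), sq_nonneg (q.eval x)]
  simp only [derivative_C_mul, eval_C_mul]
  nlinarith [mul_nonneg (sq_nonneg p.leadingCoeff) (sub_nonneg.2 (key m))]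

theorem Polynomial.Splits.coeff_mul_coeff_le {p : ℝ[X]} (hp : p.Splits) (l : ℕ) :
    p.coeff l * p.coeff (l + 2) ≤ p.coeff (l + 1) ^ 2 := by
  have hl : (derivative^[l] p).Splits := by
    induction l with
    | zero => exact hp
    | succ l ih =>
      rw [Function.iterate_succ_apply']
      exact ih.real_derivative
  have h := hl.eval_mul_eval_derivative_derivative_le 0
  simp only [← coeff_zero_eq_eval_zero, coeff_derivative, coeff_iterate_derivative] at h
  have e1 : (0 + l).descFactorial l = l.factorial := by simp [Nat.descFactorial_self]
  have e2 : (0 + 1 + l).descFactorial l = (l + 1).factorial := by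
    have := Nat.factorial_mul_descFactorial (n := 0 + 1 + l) (k := l) (by omega)
    rw [show 0 + 1 + l - l = 1 by omega, Nat.factorial_one, one_mul] at this
    rw [this]; congr 1; omega
  have e3 : 2 * (0 + 1 + 1 + l).descFactorial l = (l + 2).factorial := by
    have := Nat.factorial_mul_descFactorial (n := 0 + 1 + 1 + l) (k := l) (by omega)
    rw [show 0 + 1 + 1 + l - l = 2 by omega, Nat.factorial_two] at this
    rw [this]; congr 1; omega
  have e3' : (2 : ℝ) * ((0 + 1 + 1 + l).descFactorial l : ℕ) = (l + 2) * ((l + 1) * l.factorial) := by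
    have : ((2 * (0 + 1 + 1 + l).descFactorial l : ℕ) : ℝ) = ((l + 2).factorial : ℕ) := by rw [e3]
    rw [Nat.factorial_succ, Nat.factorial_succ] at this
    push_cast at this ⊢
    linarith
  rw [e1, e2, show 0 + l = l by omega, show 0 + 1 + l = l + 1 by omega,
    show 0 + 1 + 1 + l = l + 2 by omega] at h
  rw [show 0 + 1 + 1 + l = l + 2 by omega] at e3'
  simp only [nsmul_eq_mul, Nat.factorial_succ] at h
  push_cast at h e3'
  generalize ((l + 2).descFactorial l : ℝ) = d at h e3'
  have hF : (0 : ℝ) < l.factorial := by exact_mod_cast l.factorial_pos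
  generalize (l.factorial : ℝ) = F at h e3' hF
  generalize p.coeff l = a at h ⊢
  generalize p.coeff (l + 1) = b at h ⊢
  generalize p.coeff (l + 2) = c at h ⊢
  have hl0 : (0 : ℝ) ≤ l := l.cast_nonneg
  generalize (l : ℝ) = L at h e3' hl0
  have h' : (F ^ 2 * (L + 1)) * ((L + 2) * (a * c)) ≤ (F ^ 2 * (L + 1)) * ((L + 1) * b ^ 2) := by
    have e : (F ^ 2 * (L + 1)) * ((L + 2) * (a * c)) = F * a * (d * c * 2) := by
      linear_combination - F * a * c * e3'
    rw [e]
    norm_num at h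
    nlinarith [h]
  have h'' := le_of_mul_le_mul_left h' (by positivity)
  by_contra! hlt
  nlinarith [sq_nonneg b]

end Newton

section Garding

variable {ι : Type*} (f : ι → ℝ)

theorem esymmOn_mul_esymmOn_le (s : Finset ι) (j : ℕ) :
    esymmOn f s j * esymmOn f s (j + 2) ≤ esymmOn f s (j + 1) ^ 2 := by
  by_cases hj : j + 2 ≤ s.card
  · have hsp : (∏ i ∈ s, (Polynomial.X + Polynomial.C (f i))).Splits :=
      Polynomial.Splits.prod fun i _ => Polynomial.Splits.X_add_C (f i)
    have h := hsp.coeff_mul_coeff_le (s.card - (j + 2))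
    rw [Finset.prod_X_add_C_coeff _ _ (by omega), Finset.prod_X_add_C_coeff _ _ (by omega),
      Finset.prod_X_add_C_coeff _ _ (by omega), show s.card - (s.card - (j + 2)) = j + 2 by omega,
      show s.card - (s.card - (j + 2) + 2) = j by omega,
      show s.card - (s.card - (j + 2) + 1) = j + 1 by omega] at h
    rw [mul_comm]
    exact h
  · have h0 : esymmOn f s (j + 2) = 0 := by
      simp [esymmOn, powersetCard_eq_empty.2 (not_le.1 hj)]
    rw [h0, mul_zero]
    positivity

variable {f} [DecidableEq ι] {s : Finset ι} {a : ι} {k : ℕ}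

theorem esymmOn_erase_pos (ha : a ∈ s) (h : ∀ j ≤ k + 1, 0 < esymmOn f s j) :
    ∀ j ≤ k, 0 < esymmOn f (s.erase a) j := by
  intro j
  induction j with
  | zero => simp
  | succ j ih =>
    intro hj
    have h0 := ih (by omega)
    have h1 := h (j + 1) (by omega)
    have h2 := h (j + 2) (by omega)
    have hN := esymmOn_mul_esymmOn_le f (s.erase a) j
    rw [esymmOn_eq_erase f ha] at h1 h2
    by_contra! hneg
    nlinarith [mul_pos h0 h2, mul_nonneg h1.le (neg_nonneg.2 hneg)]

theorem esymmOn_erase_pos_of_nonpos (ha : a ∈ s) (hfa : f a ≤ 0)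
    (h : ∀ j ≤ k, 0 < esymmOn f s j) : ∀ j ≤ k, 0 < esymmOn f (s.erase a) j := by
  intro j
  induction j with
  | zero => simp
  | succ j ih =>
    intro hj
    have h0 := ih (by omega)
    have h1 := h (j + 1) hj
    rw [esymmOn_eq_erase f ha] at h1
    nlinarith

theorem mul_esymmOn_erase_le {b : ι} {δ : ℝ} (hδ0 : 0 ≤ δ) (hδ1 : δ ≤ 1) (ha : a ∈ s) (hb : b ∈ s)
    (hfa : 0 < f a) (hab : δ * f b ≤ f a) (h : ∀ j ≤ k + 2, 0 < esymmOn f s j) :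
    δ * (f b * esymmOn f (s.erase b) k) ≤ f a * esymmOn f (s.erase a) k := by
  have hy := esymmOn_erase_pos (k := k + 1) ha h k (by omega)
  have hx := esymmOn_erase_pos (k := k + 1) hb h k (by omega)
  rcases le_or_gt (f b) (f a) with hle | hlt
  · have hmain : f b * esymmOn f (s.erase b) k ≤ f a * esymmOn f (s.erase a) k := by
      rcases eq_or_ne a b with rfl | hne
      · exact le_rfl
      have hp := esymmOn_erase_pos (k := k) (mem_erase.2 ⟨hne.symm, hb⟩)
        (esymmOn_erase_pos (k := k + 1) ha h) k le_rfl
      have h1 := esymmOn_eq_erase f (mem_erase.2 ⟨hne.symm, hb⟩) k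
      have h2 := esymmOn_eq_erase f (mem_erase.2 ⟨hne, ha⟩) k
      have h3 := esymmOn_eq_erase f ha k
      have h4 := esymmOn_eq_erase f hb k
      rw [erase_right_comm] at h2
      nlinarith [mul_nonneg (sub_nonneg.2 hle) hp.le]
    have := mul_pos hfa hy
    nlinarith
  · have hne : a ≠ b := by
      rintro rfl
      exact lt_irrefl _ hlt
    have hxy : esymmOn f (s.erase b) k ≤ esymmOn f (s.erase a) k := by
      cases k with
      | zero => simp
      | succ k =>
        have hp := esymmOn_erase_pos (k := k + 1) (mem_erase.2 ⟨hne.symm, hb⟩)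
          (esymmOn_erase_pos (k := k + 2) ha h) k (by omega)
        rw [esymmOn_eq_erase f (mem_erase.2 ⟨hne.symm, hb⟩) k,
          esymmOn_eq_erase f (mem_erase.2 ⟨hne, ha⟩) k, erase_right_comm]
        nlinarith
    calc δ * (f b * esymmOn f (s.erase b) k) = δ * f b * esymmOn f (s.erase b) k := by ring
      _ ≤ f a * esymmOn f (s.erase b) k := by gcongr
      _ ≤ f a * esymmOn f (s.erase a) k := by gcongr

theorem mul_esymmOn_le_card_mul {δ : ℝ} (hδ0 : 0 ≤ δ) (hδ1 : δ ≤ 1) (ha : a ∈ s) (hfa : 0 < f a)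
    (hab : ∀ b ∈ s, δ * f b ≤ f a) (h : ∀ j ≤ k + 2, 0 < esymmOn f s j) :
    δ * ((k + 1) * esymmOn f s (k + 1)) ≤ s.card * (f a * esymmOn f (s.erase a) k) := by
  rw [← sum_mul_esymmOn_erase, mul_sum, ← nsmul_eq_mul]
  exact sum_le_card_nsmul _ _ _ fun b hb => mul_esymmOn_erase_le hδ0 hδ1 ha hb hfa (hab b hb) h

end Garding

theorem esymm_natCast {n : ℕ} (lam : Fin n → ℝ) (m : ℕ) :
    esymm lam (m : ℤ) = esymmOn lam univ m := by
  simp [esymm, esymmOn]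

theorem esymmDelSet_natCast {n : ℕ} (lam : Fin n → ℝ) (S : Finset (Fin n)) (m : ℕ) :
    esymmDelSet lam S (m : ℤ) = esymmOn lam (univ \ S) m := by
  simp [esymmDelSet, esymmOn]

/-- Display (2.18): if n ≥ 3, 2 ≤ k ≤ n, λ ∈ Γ_k with λ₂ ≥ ⋯ ≥ λₙ, λ₁ > 0, λₙ < 0,
λ₁ ≥ δλ₂ and −λₙ ≥ ελ₁ for δ, ε ∈ (0,1], then for every 1 ≤ m ≤ k−1,
(−λₙ)·σ_{m−1}(λ|1n) ≥ εδ·(m/(n−1))·σ_m(λ). -/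
theorem neg_lamn_mul_esymmDel_ge (n k : ℕ) (hn : 3 ≤ n) (hk2 : 2 ≤ k) (hkn : k ≤ n)
    (lam : Fin n → ℝ) (δ ε : ℝ) (hδ0 : 0 < δ) (hδ1 : δ ≤ 1) (hε0 : 0 < ε) (hε1 : ε ≤ 1)
    (hlam : lam ∈ GardingCone n k)
    (hsort : ∀ i j : Fin n, 1 ≤ (i : ℕ) → i ≤ j → lam j ≤ lam i)
    (h1pos : 0 < lam ⟨0, by omega⟩)
    (hnneg : lam ⟨n - 1, by omega⟩ < 0)
    (hδlam : lam ⟨0, by omega⟩ ≥ δ * lam ⟨1, by omega⟩)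
    (hεlam : -lam ⟨n - 1, by omega⟩ ≥ ε * lam ⟨0, by omega⟩) :
    ∀ m : ℕ, 1 ≤ m → m ≤ k - 1 →
      (-lam ⟨n - 1, by omega⟩) *
          esymmDelSet lam {⟨0, by omega⟩, ⟨n - 1, by omega⟩} ((m : ℤ) - 1)
        ≥ ε * δ * ((m : ℝ) / ((n : ℝ) - 1)) * esymm lam (m : ℤ) := by
  intro m hm1 hmk
  obtain ⟨j, rfl⟩ : ∃ j, m = j + 1 := ⟨m - 1, by omega⟩
  rw [show ((j + 1 : ℕ) : ℤ) - 1 = (j : ℕ) by push_cast; ring, esymm_natCast, esymmDelSet_natCast]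
  have hsdiff : (univ \ {⟨0, by omega⟩, ⟨n - 1, by omega⟩} : Finset (Fin n)) =
      (univ.erase ⟨n - 1, by omega⟩).erase ⟨0, by omega⟩ := by
    ext x
    simp
  rw [hsdiff]
  have hG : ∀ i ≤ k, 0 < esymmOn lam univ i := by
    intro i hi
    rcases Nat.eq_zero_or_pos i with rfl | h
    · simp
    · rw [← esymm_natCast]
      exact hlam i h hi
  have hδall : ∀ i, δ * lam i ≤ lam ⟨0, by omega⟩ := by
    intro i
    rcases Nat.eq_zero_or_pos (i : ℕ) with h | h
    · rw [show i = ⟨0, by omega⟩ from Fin.ext h]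
      nlinarith
    · have := hsort ⟨1, by omega⟩ i le_rfl h
      nlinarith
  have h0mem : (⟨0, by omega⟩ : Fin n) ∈ univ.erase (⟨n - 1, by omega⟩ : Fin n) := by
    simp only [mem_erase, ne_eq, Fin.mk.injEq, mem_univ, and_true]
    omega
  have hcard : ((univ.erase (⟨n - 1, by omega⟩ : Fin n)).card : ℝ) = n - 1 := by
    rw [card_erase_of_mem (mem_univ _), card_univ, Fintype.card_fin, Nat.cast_sub (by omega),
      Nat.cast_one]
  have hT := esymmOn_erase_pos_of_nonpos (mem_univ _) hnneg.le hG
  have hle := esymmOn_eq_erase lam (mem_univ (⟨n - 1, by omega⟩ : Fin n)) j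
  have hmain := mul_esymmOn_le_card_mul (k := j) hδ0.le hδ1 h0mem h1pos (fun b _ => hδall b)
    fun i hi => hT i (by omega)
  have hS := esymmOn_erase_pos (k := j) h0mem (fun i hi => hT i (by omega)) j le_rfl
  have hTj := hT j (by omega)
  rw [hcard] at hmain
  have hn1 : (0 : ℝ) < n - 1 := by
    have : (3 : ℝ) ≤ n := by exact_mod_cast hn
    linarith
  have hle' : esymmOn lam univ (j + 1) ≤ esymmOn lam (univ.erase ⟨n - 1, by omega⟩) (j + 1) := by
    nlinarith
  push_cast
  calc ε * δ * ((j + 1 : ℝ) / (n - 1)) * esymmOn lam univ (j + 1)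
      ≤ ε * δ * ((j + 1 : ℝ) / (n - 1)) *
          esymmOn lam (univ.erase ⟨n - 1, by omega⟩) (j + 1) := by gcongr
    _ = ε * (δ * ((j + 1) * esymmOn lam (univ.erase ⟨n - 1, by omega⟩) (j + 1)) / (n - 1)) := by
        ring
    _ ≤ ε * (lam ⟨0, by omega⟩ *
          esymmOn lam ((univ.erase ⟨n - 1, by omega⟩).erase ⟨0, by omega⟩) j) := by
        gcongr
        rw [div_le_iff₀ hn1]
        linarith
    _ = ε * lam ⟨0, by omega⟩ *
          esymmOn lam ((univ.erase ⟨n - 1, by omega⟩).erase ⟨0, by omega⟩) j := by ring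
    _ ≤ _ := by gcongr
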